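/- Let ν(m) denote the number of 1's in the binary representation of the natural number m, and let e(n) = deg B_n(t) be the degree of the n-th Stern polynomial. Then for every natural number n, e(n+1) = max{ν(n-i) - ν(i) : 0 ≤ i ≤ n} and -e(n+1) = min{ν(n-i) - ν(i) : 0 ≤ i ≤ n} (the maximum and minimum taken over integers, since ν(n-i) - ν(i) may be negative). -/

import Mathlib

open Polynomial

/-- The Stern polynomials: `B 0 = 0`, `B 1 = 1`, `B (2n) = t * B n`,
`B (2n+1) = B n + B (n+1)`. -/
noncomputable def stern : ℕ → Polynomial ℤ
  | 0 => 0
  | 1 => 1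
  | n + 2 =>
    if _h : n % 2 = 0 then
      X * stern (n / 2 + 1)
    else
      stern (n / 2 + 1) + stern (n / 2 + 2)
  decreasing_by all_goals omega

/-- `nu m` is the number of ones in the binary expansion of `m`. -/
def nu (m : ℕ) : ℕ := (Nat.digits 2 m).sum

/-- `e n` is the degree of the `n`-th Stern polynomial. -/
noncomputable def e (n : ℕ) : ℕ := (stern n).natDegree

theorem stern_even (m : ℕ) : stern (2 * (m + 1)) = X * stern (m + 1) := by
  rw [show 2 * (m + 1) = 2 * m + 2 by ring, stern, dif_pos (by omega)]
  congr 2; omega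

theorem stern_odd (m : ℕ) : stern (2 * (m + 1) + 1) = stern (m + 1) + stern (m + 2) := by
  rw [show 2 * (m + 1) + 1 = (2 * m + 1) + 2 by ring, stern, dif_neg (by omega)]
  have : (2 * m + 1) / 2 = m := by omega
  rw [this]

def PosPoly (p : Polynomial ℤ) : Prop := (∀ k, 0 ≤ p.coeff k) ∧ p ≠ 0

theorem PosPoly.natDegree_add {p q : Polynomial ℤ} (hp : PosPoly p) (hq : PosPoly q) :
    PosPoly (p + q) ∧ (p + q).natDegree = max p.natDegree q.natDegree := by
  have h1 : 0 < (p + q).coeff p.natDegree := by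
    have h2 := hq.1 p.natDegree
    have h3 := hp.1 p.natDegree
    have h4 : p.coeff p.natDegree ≠ 0 := by simpa using hp.2
    rw [coeff_add]; omega
  have h1' : 0 < (p + q).coeff q.natDegree := by
    have h2 := hq.1 q.natDegree
    have h3 := hp.1 q.natDegree
    have h4 : q.coeff q.natDegree ≠ 0 := by simpa using hq.2
    rw [coeff_add]; omega
  refine ⟨⟨fun k => ?_, ?_⟩, le_antisymm (natDegree_add_le _ _) (max_le ?_ ?_)⟩
  · rw [coeff_add]; exact add_nonneg (hp.1 k) (hq.1 k)
  · intro h; simp [h] at h1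
  · exact le_natDegree_of_ne_zero h1.ne'
  · exact le_natDegree_of_ne_zero h1'.ne'

theorem PosPoly.X_mul {p : Polynomial ℤ} (hp : PosPoly p) : PosPoly (X * p) := by
  refine ⟨fun k => ?_, mul_ne_zero X_ne_zero hp.2⟩
  cases k with
  | zero => simp
  | succ k => rw [coeff_X_mul]; exact hp.1 k

theorem nat_cases (n : ℕ) : n = 0 ∨ (∃ m, n = 2 * m + 1) ∨ ∃ m, n = 2 * (m + 1) := by
  rcases Nat.even_or_odd' n with ⟨m, h | h⟩
  · cases m with
    | zero => left; omega
    | succ m => right; right; exact ⟨m, h⟩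
  · right; left; exact ⟨m, h⟩

theorem stern_pos (n : ℕ) : PosPoly (stern (n + 1)) := by
  induction n using Nat.strong_induction_on with
  | _ n ih =>
    rcases nat_cases n with rfl | ⟨m, rfl⟩ | ⟨m, rfl⟩
    · rw [stern]
      refine ⟨fun k => ?_, one_ne_zero⟩
      rw [coeff_one]; split_ifs <;> simp
    · rw [show 2 * m + 1 + 1 = 2 * (m + 1) by ring, stern_even]
      exact (ih m (by omega)).X_mul
    · rw [stern_odd]
      exact ((ih m (by omega)).natDegree_add (ih (m + 1) (by omega))).1

theorem e_even (m : ℕ) : e (2 * m + 1 + 1) = e (m + 1) + 1 := by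
  rw [show 2 * m + 1 + 1 = 2 * (m + 1) by ring, e, stern_even, natDegree_X_mul (stern_pos m).2, e]

theorem e_odd (m : ℕ) : e (2 * (m + 1) + 1) = max (e (m + 1)) (e (m + 1 + 1)) := by
  rw [e, stern_odd, ((stern_pos m).natDegree_add (stern_pos (m + 1))).2, e, e]

theorem nu_zero : nu 0 = 0 := by simp [nu]

theorem nu_even (m : ℕ) : nu (2 * m) = nu m := by
  rcases Nat.eq_zero_or_pos m with rfl | h
  · simp
  · rw [nu, Nat.digits_def' (by norm_num) (by omega)]
    simp [nu]

theorem nu_odd (m : ℕ) : nu (2 * m + 1) = nu m + 1 := by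
  rw [nu, Nat.digits_def' (by norm_num) (by omega)]
  have h1 : (2 * m + 1) % 2 = 1 := by omega
  have h2 : (2 * m + 1) / 2 = m := by omega
  rw [h1, h2]
  simp [nu, add_comm]

theorem upper (n : ℕ) : ∀ a b : ℕ, a + b = n → nu a ≤ nu b + e (n + 1) := by
  induction n using Nat.strong_induction_on with
  | _ n ih =>
    intro a b hab
    rcases nat_cases n with rfl | ⟨m, rfl⟩ | ⟨m, rfl⟩
    · have : a = b := by omega
      subst this; omega
    · have := ih m (by omega) (a / 2) (b / 2) (by omega)
      rw [e_even]
      rcases Nat.even_or_odd' a with ⟨c, rfl | rfl⟩ <;>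
      rcases Nat.even_or_odd' b with ⟨d, rfl | rfl⟩
      · omega
      · have := ih m (by omega) c d (by omega)
        rw [nu_even, nu_odd]; omega
      · have := ih m (by omega) c d (by omega)
        rw [nu_even, nu_odd]; omega
      · omega
    · rw [e_odd]
      rcases Nat.even_or_odd' a with ⟨c, rfl | rfl⟩ <;>
      rcases Nat.even_or_odd' b with ⟨d, rfl | rfl⟩
      · have := ih (m + 1) (by omega) c d (by omega)
        rw [nu_even, nu_even]; omega
      · omega
      · omega
      · have := ih m (by omega) c d (by omega)
        rw [nu_odd, nu_odd]; omega

theorem attained (n : ℕ) : ∃ a b : ℕ, a + b = n ∧ nu a = nu b + e (n + 1) := by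
  induction n using Nat.strong_induction_on with
  | _ n ih =>
    rcases nat_cases n with rfl | ⟨m, rfl⟩ | ⟨m, rfl⟩
    · exact ⟨0, 0, rfl, by simp [e, stern]⟩
    · obtain ⟨c, d, h, h'⟩ := ih m (by omega)
      refine ⟨2 * c + 1, 2 * d, by omega, ?_⟩
      rw [e_even, nu_odd, nu_even]; omega
    · rw [e_odd]
      rcases le_total (e (m + 1)) (e (m + 1 + 1)) with hl | hl
      · obtain ⟨c, d, h, h'⟩ := ih (m + 1) (by omega)
        refine ⟨2 * c, 2 * d, by omega, ?_⟩
        rw [nu_even, nu_even]; omega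
      · obtain ⟨c, d, h, h'⟩ := ih m (by omega)
        refine ⟨2 * c + 1, 2 * d + 1, by omega, ?_⟩
        rw [nu_odd, nu_odd]; omega

theorem stern_degree_eq_max_nu_diff (n : ℕ) :
    IsGreatest {x : ℤ | ∃ i : ℕ, i ≤ n ∧ x = (nu (n - i) : ℤ) - (nu i : ℤ)}
      ((e (n + 1) : ℤ)) ∧
    IsLeast {x : ℤ | ∃ i : ℕ, i ≤ n ∧ x = (nu (n - i) : ℤ) - (nu i : ℤ)}
      (-(e (n + 1) : ℤ)) := by
  obtain ⟨a, b, hab, h⟩ := attained n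
  refine ⟨⟨⟨b, by omega, ?_⟩, ?_⟩, ⟨⟨a, by omega, ?_⟩, ?_⟩⟩
  · rw [show n - b = a by omega]; omega
  · rintro x ⟨i, hi, rfl⟩
    have := upper n (n - i) i (by omega)
    omega
  · rw [show n - a = b by omega]; omega
  · rintro x ⟨i, hi, rfl⟩
    have := upper n i (n - i) (by omega)
    omega
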